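/- Let V, λ, u be as in the Fermi-coordinate setup, let σ and c be real numbers, and assume the Steklov boundary condition −u_x(0,y) = σ·u(0,y) holds for all y ∈ ℝ and the constant-gradient condition u_x(0,y)² + u_y(0,y)² = c² holds for all y ∈ ℝ. Then for every y₀ ∈ ℝ with u_y(0,y₀) ≠ 0 one has (1/2)·∂_x[u_x² + λ^{−2}·u_y²](0,y₀) = −(σ + λ_x(0,y₀))·(u_x(0,y₀)² + u_y(0,y₀)²); equivalently, −(1/2)·∂_x[log(u_x² + λ^{−2}·u_y²)](0,y₀) = σ − κ(y₀), where κ(y₀) = −λ_x(0,y₀). -/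

import Mathlib

/-- Partial derivative of `f : ℝ² → ℝ` with respect to the first coordinate. -/
noncomputable def pderiv1 (f : ℝ × ℝ → ℝ) (p : ℝ × ℝ) : ℝ :=
  deriv (fun x : ℝ => f (x, p.2)) p.1

/-- Partial derivative of `f : ℝ² → ℝ` with respect to the second coordinate. -/
noncomputable def pderiv2 (f : ℝ × ℝ → ℝ) (p : ℝ × ℝ) : ℝ :=
  deriv (fun y : ℝ => f (p.1, y)) p.2

theorem hasDerivAt_pderiv1 {f : ℝ × ℝ → ℝ} {p : ℝ × ℝ} (hf : DifferentiableAt ℝ f p) :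
    HasDerivAt (fun x : ℝ => f (x, p.2)) (pderiv1 f p) p.1 :=
  (DifferentiableAt.comp (f := fun x : ℝ => (x, p.2)) p.1 hf (by fun_prop)).hasDerivAt

theorem hasDerivAt_pderiv2 {f : ℝ × ℝ → ℝ} {p : ℝ × ℝ} (hf : DifferentiableAt ℝ f p) :
    HasDerivAt (fun y : ℝ => f (p.1, y)) (pderiv2 f p) p.2 :=
  (DifferentiableAt.comp (f := fun y : ℝ => (p.1, y)) p.2 hf (by fun_prop)).hasDerivAt

theorem pderiv1_eq_fderiv {f : ℝ × ℝ → ℝ} {p : ℝ × ℝ} (hf : DifferentiableAt ℝ f p) :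
    pderiv1 f p = fderiv ℝ f p (1, 0) :=
  (HasFDerivAt.comp_hasDerivAt (f := fun x : ℝ => (x, p.2)) p.1 hf.hasFDerivAt
    ((hasDerivAt_id p.1).prodMk (hasDerivAt_const p.1 p.2))).deriv

theorem pderiv2_eq_fderiv {f : ℝ × ℝ → ℝ} {p : ℝ × ℝ} (hf : DifferentiableAt ℝ f p) :
    pderiv2 f p = fderiv ℝ f p (0, 1) :=
  (HasFDerivAt.comp_hasDerivAt (f := fun y : ℝ => (p.1, y)) p.2 hf.hasFDerivAt
    ((hasDerivAt_const p.2 p.1).prodMk (hasDerivAt_id p.2))).deriv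

section ContDiffAt

variable {f : ℝ × ℝ → ℝ} {p : ℝ × ℝ}

theorem ContDiffAt.eventually_differentiableAt_two (hf : ContDiffAt ℝ 2 f p) :
    ∀ᶠ q in nhds p, DifferentiableAt ℝ f q :=
  (hf.eventually (by simp)).mono fun _ hq => hq.differentiableAt two_ne_zero

theorem ContDiffAt.differentiableAt_fderiv_two (hf : ContDiffAt ℝ 2 f p) :
    DifferentiableAt ℝ (fderiv ℝ f) p :=
  (hf.fderiv_right (m := 1) (by norm_num)).differentiableAt one_ne_zero

theorem ContDiffAt.pderiv1_eventuallyEq (hf : ContDiffAt ℝ 2 f p) :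
    pderiv1 f =ᶠ[nhds p] fun q => fderiv ℝ f q (1, 0) :=
  hf.eventually_differentiableAt_two.mono fun _ hq => pderiv1_eq_fderiv hq

theorem ContDiffAt.pderiv2_eventuallyEq (hf : ContDiffAt ℝ 2 f p) :
    pderiv2 f =ᶠ[nhds p] fun q => fderiv ℝ f q (0, 1) :=
  hf.eventually_differentiableAt_two.mono fun _ hq => pderiv2_eq_fderiv hq

theorem ContDiffAt.differentiableAt_pderiv1 (hf : ContDiffAt ℝ 2 f p) :
    DifferentiableAt ℝ (pderiv1 f) p :=
  (hf.differentiableAt_fderiv_two.clm_apply (differentiableAt_const _)).congr_of_eventuallyEq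
    hf.pderiv1_eventuallyEq

theorem ContDiffAt.differentiableAt_pderiv2 (hf : ContDiffAt ℝ 2 f p) :
    DifferentiableAt ℝ (pderiv2 f) p :=
  (hf.differentiableAt_fderiv_two.clm_apply (differentiableAt_const _)).congr_of_eventuallyEq
    hf.pderiv2_eventuallyEq

theorem ContDiffAt.pderiv1_pderiv2_comm (hf : ContDiffAt ℝ 2 f p) :
    pderiv1 (pderiv2 f) p = pderiv2 (pderiv1 f) p := by
  have hd := hf.differentiableAt_fderiv_two
  rw [pderiv1_eq_fderiv hf.differentiableAt_pderiv2, pderiv2_eq_fderiv hf.differentiableAt_pderiv1,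
    hf.pderiv2_eventuallyEq.fderiv_eq, hf.pderiv1_eventuallyEq.fderiv_eq,
    fderiv_clm_apply hd (differentiableAt_const _), fderiv_clm_apply hd (differentiableAt_const _)]
  simpa using (hf.isSymmSndFDerivAt (by simp)).eq (1, 0) (0, 1)

end ContDiffAt

/-- Fermi-coordinate computation behind Claim 2: with the Steklov boundary condition
`−u_x(0,y) = σ·u(0,y)` and constant-gradient condition `u_x(0,y)² + u_y(0,y)² = c²`,
at every boundary point where `u_y(0,y₀) ≠ 0` one has
`(1/2)·∂_x[u_x² + λ⁻²·u_y²](0,y₀) = −(σ + λ_x(0,y₀))·(u_x(0,y₀)² + u_y(0,y₀)²)`;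
equivalently `−(1/2)·∂_x[log(u_x² + λ⁻²·u_y²)](0,y₀) = σ − κ(y₀)` with
`κ(y₀) = −λ_x(0,y₀)`. -/
theorem fermi_boundary_identity_claim2
    (V : Set (ℝ × ℝ)) (hV : IsOpen V) (hV0 : ∀ y : ℝ, ((0 : ℝ), y) ∈ V)
    (lam : ℝ × ℝ → ℝ) (hlam : ContDiffOn ℝ (⊤ : ℕ∞) lam V)
    (hlampos : ∀ p ∈ V, 0 < lam p) (hlam1 : ∀ y : ℝ, lam (0, y) = 1)
    (u : ℝ × ℝ → ℝ) (hu : ContDiffOn ℝ (⊤ : ℕ∞) u V)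
    (hharm : ∀ p ∈ V,
      pderiv1 (pderiv1 u) p + ((lam p) ^ 2)⁻¹ * pderiv2 (pderiv2 u) p +
        (pderiv1 lam p / lam p) * pderiv1 u p -
        (pderiv2 lam p / (lam p) ^ 3) * pderiv2 u p = 0)
    (σ c : ℝ)
    (hsteklov : ∀ y : ℝ, -(pderiv1 u (0, y)) = σ * u (0, y))
    (hconstgrad : ∀ y : ℝ, (pderiv1 u (0, y)) ^ 2 + (pderiv2 u (0, y)) ^ 2 = c ^ 2) :
    ∀ y₀ : ℝ, pderiv2 u (0, y₀) ≠ 0 →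
      (1 / 2) * pderiv1
          (fun p => (pderiv1 u p) ^ 2 + ((lam p) ^ 2)⁻¹ * (pderiv2 u p) ^ 2) (0, y₀)
        = -(σ + pderiv1 lam (0, y₀)) *
            ((pderiv1 u (0, y₀)) ^ 2 + (pderiv2 u (0, y₀)) ^ 2) ∧
      -(1 / 2) * pderiv1
          (fun p => Real.log ((pderiv1 u p) ^ 2 + ((lam p) ^ 2)⁻¹ * (pderiv2 u p) ^ 2))
          (0, y₀)
        = σ - (-(pderiv1 lam (0, y₀))) := by
  intro y₀ hb
  have hu2 : ∀ y : ℝ, ContDiffAt ℝ 2 u (0, y) := fun y =>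
    (hu.contDiffAt (hV.mem_nhds (hV0 y))).of_le (WithTop.coe_le_coe.2 (le_top : (2 : ℕ∞) ≤ ⊤))
  have hlamd : DifferentiableAt ℝ lam (0, y₀) :=
    (hlam.contDiffAt (hV.mem_nhds (hV0 y₀))).differentiableAt (by simp)
  have hux := (hu2 y₀).differentiableAt_pderiv1
  have huy := (hu2 y₀).differentiableAt_pderiv2
  have hmixed : pderiv2 (pderiv1 u) (0, y₀) = -σ * pderiv2 u (0, y₀) := by
    have h : (fun y : ℝ => pderiv1 u (0, y)) = fun y => -σ * u (0, y) :=
      funext fun y => by linarith [hsteklov y]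
    have h1 : HasDerivAt (fun y : ℝ => u (0, y)) (pderiv2 u (0, y₀)) y₀ :=
      hasDerivAt_pderiv2 ((hu2 y₀).differentiableAt two_ne_zero)
    change deriv (fun y : ℝ => pderiv1 u (0, y)) y₀ = _
    rw [h, (h1.const_mul (-σ)).deriv]
  have hlamy : pderiv2 lam (0, y₀) = 0 := by
    simp [pderiv2, hlam1]
  have hyy : pderiv2 (pderiv2 u) (0, y₀) = σ * pderiv1 u (0, y₀) := by
    have h1 : HasDerivAt (fun y : ℝ => pderiv1 u (0, y)) _ y₀ := hasDerivAt_pderiv2 hux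
    have h2 : HasDerivAt (fun y : ℝ => pderiv2 u (0, y)) _ y₀ := hasDerivAt_pderiv2 huy
    have h := (h1.fun_pow 2).fun_add (h2.fun_pow 2)
    simp only [hconstgrad] at h
    have h0 := h.unique (hasDerivAt_const y₀ (c ^ 2))
    rw [hmixed] at h0
    apply mul_left_cancel₀ hb
    norm_num at h0
    linarith
  have hxx := hharm (0, y₀) (hV0 y₀)
  rw [hlam1, hlamy, hyy] at hxx
  have hgrad : HasDerivAt
      (fun x : ℝ => (pderiv1 u (x, y₀)) ^ 2 + ((lam (x, y₀)) ^ 2)⁻¹ * (pderiv2 u (x, y₀)) ^ 2)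
      (-2 * (σ + pderiv1 lam (0, y₀)) * ((pderiv1 u (0, y₀)) ^ 2 + (pderiv2 u (0, y₀)) ^ 2)) 0 := by
    have h1 : HasDerivAt (fun x : ℝ => pderiv1 u (x, y₀)) _ 0 := hasDerivAt_pderiv1 hux
    have h2 : HasDerivAt (fun x : ℝ => pderiv2 u (x, y₀)) _ 0 := hasDerivAt_pderiv1 huy
    have h3 : HasDerivAt (fun x : ℝ => lam (x, y₀)) _ 0 := hasDerivAt_pderiv1 hlamd
    have h := (h1.fun_pow 2).fun_add
      (((h3.fun_pow 2).fun_inv (by simp [hlam1])).fun_mul (h2.fun_pow 2))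
    refine h.congr_deriv ?_
    rw [(hu2 y₀).pderiv1_pderiv2_comm, hmixed]
    norm_num [hlam1] at hxx ⊢
    linear_combination 2 * pderiv1 u (0, y₀) * hxx
  have hpos : 0 < (pderiv1 u (0, y₀)) ^ 2 + (pderiv2 u (0, y₀)) ^ 2 := by positivity
  constructor
  · rw [pderiv1, hgrad.deriv]
    ring
  · rw [pderiv1, (hgrad.log (by simpa [hlam1] using hpos.ne')).deriv]
    simp only [hlam1]
    field_simp
    ring
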